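/- With per-actuator lower-layer errors bounded as ‖W a − W* a‖ ≤ ε (κ a) for all a ∈ A, the approximate local Bellman operator propagates error as follows: for every value function V : S → ℝ, ‖B V − V*‖ ≤ γ · max over k ∈ K of ( α⁺_k · ‖V − V*‖ + (1 − α⁻_k) · ε k ), where V* is a fixed point of the exact operator B* (B* V* = V*). -/

import Mathlib

theorem abs_sup'_sub_sup'_le {ι : Type*} {t : Finset ι} (ht : t.Nonempty) {f g : ι → ℝ} {c : ℝ}
    (h : ∀ i ∈ t, |f i - g i| ≤ c) : |t.sup' ht f - t.sup' ht g| ≤ c := by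
  have key : ∀ u v : ι → ℝ, (∀ i ∈ t, |u i - v i| ≤ c) → t.sup' ht u ≤ t.sup' ht v + c := by
    intro u v huv
    refine Finset.sup'_le ht _ fun i hi => ?_
    linarith [(abs_le.mp (huv i hi)).2, Finset.le_sup' v hi]
  have h₁ := key f g h
  have h₂ := key g f fun i hi => by rw [abs_sub_comm]; exact h i hi
  rw [abs_le]
  constructor <;> linarith

theorem abs_sum_mul_le_of_sum_eq_one {ι : Type*} [Fintype ι] {p v : ι → ℝ} {M : ℝ}
    (hp : ∀ i, 0 ≤ p i) (hsum : ∑ i, p i = 1) (hv : ∀ i, |v i| ≤ M) :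
    |∑ i, p i * v i| ≤ M :=
  calc |∑ i, p i * v i| ≤ ∑ i, |p i * v i| := Finset.abs_sum_le_sum_abs _ _
    _ ≤ ∑ i, p i * M := by
      refine Finset.sum_le_sum fun i _ => ?_
      rw [abs_mul, abs_of_nonneg (hp i)]
      exact mul_le_mul_of_nonneg_left (hv i) (hp i)
    _ = M := by rw [← Finset.sum_mul, hsum, one_mul]

theorem stmt5
    {S A : Type} [Fintype S] [Nonempty S] [Fintype A] [Nonempty A]
    (α : S → A → ℝ) (T F : S → A → S → ℝ) (R : S → A → ℝ) (γ : ℝ)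
    (W : A → S → ℝ)
    (hα : ∀ s a, 0 ≤ α s a ∧ α s a ≤ 1)
    (hT : ∀ s a s', 0 ≤ T s a s') (hTsum : ∀ s a, ∑ s', T s a s' = 1)
    (hF : ∀ s a s', 0 ≤ F s a s') (hFsum : ∀ s a, ∑ s', F s a s' = 1)
    (hγ : 0 ≤ γ ∧ γ ≤ 1)
    (B : (S → ℝ) → (S → ℝ))
    (hB : ∀ V s, B V s =
      Finset.univ.sup' Finset.univ_nonempty (fun a : A =>
        R s a + γ * ∑ s', (α s a * T s a s' * V s' +
          (1 - α s a) * F s a s' * W a s')))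
    (norm' : (S → ℝ) → ℝ)
    (hnorm : ∀ V, norm' V = Finset.univ.sup' Finset.univ_nonempty (fun s : S => |V s|))
    (aplus : ℝ)
    (haplus : aplus = Finset.univ.sup' Finset.univ_nonempty (fun p : S × A => α p.1 p.2))
    {K : Type} [Fintype K] [Nonempty K] [DecidableEq K]
    (κ : A → K) (hκ : Function.Surjective κ)
    (hKne : ∀ k : K, (Finset.univ.filter (fun p : S × A => κ p.2 = k)).Nonempty)
    (aplusk ainfk : K → ℝ)
    (haplusk : ∀ k, aplusk k =
      (Finset.univ.filter (fun p : S × A => κ p.2 = k)).sup' (hKne k) (fun p => α p.1 p.2))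
    (hainfk : ∀ k, ainfk k =
      (Finset.univ.filter (fun p : S × A => κ p.2 = k)).inf' (hKne k) (fun p => α p.1 p.2))
    (Wstar : A → S → ℝ)
    (Bstar : (S → ℝ) → (S → ℝ))
    (hBstar : ∀ V s, Bstar V s =
      Finset.univ.sup' Finset.univ_nonempty (fun a : A =>
        R s a + γ * ∑ s', (α s a * T s a s' * V s' +
          (1 - α s a) * F s a s' * Wstar a s')))
    (ε : K → ℝ)
    (herr : ∀ a : A, norm' (fun s => W a s - Wstar a s) ≤ ε (κ a))
    (Vstar : S → ℝ) (hfix : Bstar Vstar = Vstar)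
    : ∀ V : S → ℝ,
      norm' (fun s => B V s - Vstar s) ≤
        γ * Finset.univ.sup' Finset.univ_nonempty (fun k : K =>
          aplusk k * norm' (fun s => V s - Vstar s) + (1 - ainfk k) * ε k) := by
  intro V
  have abs_le_norm : ∀ (U : S → ℝ) (s : S), |U s| ≤ norm' U := fun U s => by
    rw [hnorm]
    exact Finset.le_sup' (fun s => |U s|) (Finset.mem_univ s)
  rw [hnorm (fun s => B V s - Vstar s)]
  refine Finset.sup'_le _ _ fun s _ => ?_
  have hVs : Vstar s = Bstar Vstar s := by rw [hfix]
  rw [hVs, hB, hBstar]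
  refine abs_sup'_sub_sup'_le _ fun a _ => ?_
  have hmem : (s, a) ∈ Finset.univ.filter (fun p : S × A => κ p.2 = κ a) := by simp
  have hup : α s a ≤ aplusk (κ a) := by
    rw [haplusk]
    exact Finset.le_sup' (fun p : S × A => α p.1 p.2) hmem
  have hlow : ainfk (κ a) ≤ α s a := by
    rw [hainfk]
    exact Finset.inf'_le (fun p : S × A => α p.1 p.2) hmem
  have hN : 0 ≤ norm' (fun s => V s - Vstar s) :=
    (abs_nonneg _).trans (abs_le_norm (fun s => V s - Vstar s) s)
  have hW : ∀ s', |W a s' - Wstar a s'| ≤ ε (κ a) := fun s' =>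
    (abs_le_norm (fun s => W a s - Wstar a s) s').trans (herr a)
  have hε : 0 ≤ ε (κ a) := (abs_nonneg _).trans (hW s)
  have hTV := abs_sum_mul_le_of_sum_eq_one (hT s a) (hTsum s a)
    (abs_le_norm (fun s => V s - Vstar s))
  have hFW := abs_sum_mul_le_of_sum_eq_one (hF s a) (hFsum s a) hW
  have hdiff : (R s a + γ * ∑ s', (α s a * T s a s' * V s' +
        (1 - α s a) * F s a s' * W a s')) -
      (R s a + γ * ∑ s', (α s a * T s a s' * Vstar s' +
        (1 - α s a) * F s a s' * Wstar a s')) =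
      γ * (α s a * ∑ s', T s a s' * (V s' - Vstar s') +
        (1 - α s a) * ∑ s', F s a s' * (W a s' - Wstar a s')) := by
    rw [add_sub_add_left_eq_sub, ← mul_sub, ← Finset.sum_sub_distrib]
    congr 1
    rw [Finset.mul_sum, Finset.mul_sum, ← Finset.sum_add_distrib]
    exact Finset.sum_congr rfl fun _ _ => by ring
  rw [hdiff, abs_mul, abs_of_nonneg hγ.1]
  refine mul_le_mul_of_nonneg_left ?_ hγ.1
  have hα₀ := (hα s a).1
  have hα₁ : 0 ≤ 1 - α s a := sub_nonneg.mpr (hα s a).2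
  refine le_trans ?_ (Finset.le_sup' (fun k : K =>
    aplusk k * norm' (fun s => V s - Vstar s) + (1 - ainfk k) * ε k) (Finset.mem_univ (κ a)))
  refine (abs_add_le _ _).trans (add_le_add ?_ ?_)
  · rw [abs_mul, abs_of_nonneg hα₀]
    exact (mul_le_mul_of_nonneg_left hTV hα₀).trans (mul_le_mul_of_nonneg_right hup hN)
  · rw [abs_mul, abs_of_nonneg hα₁]
    exact (mul_le_mul_of_nonneg_left hFW hα₁).trans
      (mul_le_mul_of_nonneg_right (sub_le_sub_left hlow 1) hε)
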